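/- For every z in the critical strip D = {z ∈ ℂ : 0 < Re z < 1} and every natural number μ ≥ 1, z is a zero of multiplicity μ of G if and only if z is a zero of multiplicity μ of the Riemann zeta function ζ; equivalently, the analytic order of vanishing of G at z equals the analytic order of vanishing of ζ at z. -/

import Mathlib

open MeasureTheory

/-- `G z = ∫₀^∞ ξ^(z-1) / (exp ξ + 1) dξ`. -/
noncomputable def G (z : ℂ) : ℂ :=
  ∫ ξ in Set.Ioi (0 : ℝ), (ξ : ℂ) ^ (z - 1) / (Real.exp ξ + 1)

/-- `z` is a zero of multiplicity `μ` of the analytic function `f`: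
all derivatives of order `< μ` vanish at `z` and the `μ`-th does not. -/
def IsZeroOfMultiplicity (f : ℂ → ℂ) (z : ℂ) (μ : ℕ) : Prop :=
  (∀ k < μ, iteratedDeriv k f z = 0) ∧ iteratedDeriv μ f z ≠ 0

open Complex HurwitzZeta Filter Topology Asymptotics

theorem cexp_two_pi_I_half_mul_nat (n : ℕ) :
    cexp (2 * Real.pi * I * (1 / 2 : ℝ) * n) = (-1) ^ n := by
  rw [show (2 * Real.pi * I * (1 / 2 : ℝ) * n : ℂ) = n * (Real.pi * I) by push_cast; ring,
    Complex.exp_nat_mul, Complex.exp_pi_mul_I]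

theorem hasSum_expZeta_half {s : ℂ} (hs : 1 < s.re) :
    HasSum (fun n : ℕ ↦ (-1 : ℂ) ^ n / (n : ℂ) ^ s) (expZeta ((1 / 2 : ℝ) : UnitAddCircle) s) := by
  simpa only [cexp_two_pi_I_half_mul_nat] using hasSum_expZeta_of_one_lt_re (1 / 2) hs

theorem hasSum_riemannZeta {s : ℂ} (hs : 1 < s.re) :
    HasSum (fun n : ℕ ↦ 1 / (n : ℂ) ^ s) (riemannZeta s) := by
  simpa [expZeta_zero] using hasSum_expZeta_of_one_lt_re 0 hs

theorem expZeta_half_of_one_lt_re {s : ℂ} (hs : 1 < s.re) :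
    expZeta ((1 / 2 : ℝ) : UnitAddCircle) s = (2 ^ (1 - s) - 1) * riemannZeta s := by
  have h₁ := (hasSum_expZeta_half hs).add (hasSum_riemannZeta hs)
  rw [← (mul_right_injective₀ (two_ne_zero' ℕ)).hasSum_iff] at h₁
  · have h₂ := (hasSum_riemannZeta hs).mul_left ((2 : ℂ) ^ (1 - s))
    rw [sub_one_mul, eq_sub_iff_add_eq]
    refine h₁.unique (h₂.congr_fun fun n ↦ ?_)
    have h2s : (2 : ℂ) ^ s ≠ 0 := by simp [cpow_eq_zero_iff]
    simp only [Function.comp_apply, pow_mul, even_two, Even.neg_pow, one_pow, Nat.cast_mul,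
      cpow_sub _ _ (two_ne_zero' ℂ), cpow_one, Nat.cast_ofNat]
    rw [show ((2 : ℂ) * n) ^ s = 2 ^ s * (n : ℂ) ^ s from mod_cast natCast_mul_natCast_cpow 2 n s]
    field_simp
    norm_num
  · intro n hn
    have hodd : Odd n := by
      rw [← Nat.not_even_iff_odd, even_iff_exists_two_mul]
      rintro ⟨k, rfl⟩
      exact hn ⟨k, rfl⟩
    rw [hodd.neg_one_pow]
    ring

theorem half_ne_zero_unitAddCircle : ((1 / 2 : ℝ) : UnitAddCircle) ≠ 0 := by
  intro h
  obtain ⟨n, hn⟩ := (AddCircle.coe_eq_zero_iff (1 : ℝ)).mp h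
  have h₂ : (2 * n : ℝ) = 1 := by
    simp only [zsmul_eq_mul, mul_one] at hn
    linarith
  norm_cast at h₂
  omega

theorem analyticAt_expZeta_half (s : ℂ) :
    AnalyticAt ℂ (expZeta ((1 / 2 : ℝ) : UnitAddCircle)) s :=
  (differentiable_expZeta_of_ne_zero half_ne_zero_unitAddCircle).analyticAt s

theorem analyticAt_two_cpow_one_sub_sub_one (s : ℂ) :
    AnalyticAt ℂ (fun s : ℂ ↦ (2 : ℂ) ^ (1 - s) - 1) s := by
  refine Differentiable.analyticAt (fun s ↦ ?_) s
  refine DifferentiableAt.sub_const (DifferentiableAt.const_cpow ?_ (Or.inl two_ne_zero)) 1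
  fun_prop

theorem eventually_one_lt_re_nhds_two : ∀ᶠ s : ℂ in 𝓝 2, 1 < s.re :=
  continuous_re.continuousAt.eventually (lt_mem_nhds (by norm_num))

theorem expZeta_half {s : ℂ} (hs : s ≠ 1) :
    expZeta ((1 / 2 : ℝ) : UnitAddCircle) s = (2 ^ (1 - s) - 1) * riemannZeta s := by
  refine AnalyticOnNhd.eqOn_of_preconnected_of_eventuallyEq
    (g := fun s ↦ (2 ^ (1 - s) - 1) * riemannZeta s) (U := {1}ᶜ) (z₀ := 2)
    (fun s _ ↦ analyticAt_expZeta_half s)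
    (fun s hs ↦ (analyticAt_two_cpow_one_sub_sub_one s).mul (analyticOn_riemannZeta s hs))
    (isConnected_compl_singleton_of_one_lt_rank (by simp) 1).isPreconnected (by simp) ?_ hs
  filter_upwards [eventually_one_lt_re_nhds_two] with s hs using expZeta_half_of_one_lt_re hs

theorem G_eq_mellin : G = mellin fun t ↦ (1 / (Real.exp t + 1) : ℂ) := by
  ext z
  simp [G, mellin, div_eq_mul_inv]

theorem G_of_one_lt_re {s : ℂ} (hs : 1 < s.re) :
    G s = -(Gamma s * expZeta ((1 / 2 : ℝ) : UnitAddCircle) s) := by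
  have hs₀ : s ≠ 0 := ne_zero_of_one_lt_re hs
  have h := hasSum_mellin (a := fun n : ℕ ↦ (if n = 0 then 1 else 0) - (-1) ^ n)
    (p := fun n ↦ (n : ℝ)) (F := fun t ↦ (1 / (Real.exp t + 1) : ℂ)) (s := s)
    (fun n ↦ ?_) (by linarith) (fun t ht ↦ ?_) ?_
  · rw [← G_eq_mellin] at h
    refine h.unique (((hasSum_expZeta_half hs).mul_left (Gamma s)).neg.congr_fun fun n ↦ ?_)
    rcases eq_or_ne n 0 with rfl | hn
    · simp [hs₀]
    · simp [hn, mul_div_assoc, neg_div]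
  · rcases eq_or_ne n 0 with rfl | hn
    · simp
    · exact Or.inr (by positivity)
  · have ht : 0 < t := ht
    have hq : ‖(-Real.exp (-t) : ℂ)‖ < 1 := by
      rw [norm_neg, norm_real, Real.norm_of_nonneg (Real.exp_pos _).le]
      simpa using ht
    convert! (hasSum_ite_eq (0 : ℕ) (1 : ℂ)).sub (hasSum_geometric_of_norm_lt_one hq) using 1
    · ext n
      rw [neg_pow (Real.exp (-t) : ℂ), ← ofReal_pow, ← Real.exp_nat_mul, sub_mul, neg_mul, mul_neg]
      rcases eq_or_ne n 0 with rfl | hn <;> simp [*]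
    · have h₁ : (Real.exp t : ℂ) ≠ 0 := mod_cast (Real.exp_pos t).ne'
      have h₂ : (Real.exp t + 1 : ℂ) ≠ 0 := mod_cast (by positivity : Real.exp t + 1 ≠ 0)
      rw [Real.exp_neg, ofReal_inv]
      have h₃ : (1 - -(Real.exp t : ℂ)⁻¹) = (Real.exp t + 1) / Real.exp t := by
        field_simp
        ring
      rw [h₃]
      field_simp
      ring
  · refine (Real.summable_one_div_nat_rpow.mpr hs).of_nonneg_of_le
      (fun n ↦ by positivity) fun n ↦ ?_
    rcases eq_or_ne n 0 with rfl | hn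
    · simp
      positivity
    · simp [hn]

theorem differentiableAt_G {s : ℂ} (hs : 0 < s.re) : DifferentiableAt ℂ G s := by
  have hpos (t : ℝ) : (Real.exp t + 1 : ℂ) ≠ 0 :=
    mod_cast (by positivity : Real.exp t + 1 ≠ 0)
  have hnorm (t : ℝ) : ‖(1 / (Real.exp t + 1) : ℂ)‖ = 1 / (Real.exp t + 1) := by
    rw [← ofReal_one, ← ofReal_add, ← ofReal_div, norm_real, Real.norm_of_nonneg (by positivity)]
  rw [G_eq_mellin]
  refine mellin_differentiableAt_of_isBigO_rpow_exp (a := 1) (b := 0) one_pos ?_ ?_ ?_ hs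
  · refine (Continuous.locallyIntegrable ?_).locallyIntegrableOn _
    exact continuous_const.div (by fun_prop) hpos
  · refine IsBigO.of_bound 1 (Eventually.of_forall fun t ↦ ?_)
    rw [hnorm, Real.norm_of_nonneg (Real.exp_pos _).le, one_mul, neg_one_mul, Real.exp_neg,
      one_div]
    gcongr
    linarith
  · refine IsBigO.of_bound 1 (Eventually.of_forall fun t ↦ ?_)
    rw [hnorm]
    simp only [neg_zero, Real.rpow_zero, norm_one, mul_one]
    rw [div_le_one (by positivity)]
    linarith [Real.exp_pos t]

theorem isOpen_zero_lt_re : IsOpen {s : ℂ | 0 < s.re} :=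
  isOpen_lt continuous_const continuous_re

theorem analyticAt_G {s : ℂ} (hs : 0 < s.re) : AnalyticAt ℂ G s :=
  DifferentiableOn.analyticAt (s := {s : ℂ | 0 < s.re})
    (fun _ h ↦ (differentiableAt_G h).differentiableWithinAt) (isOpen_zero_lt_re.mem_nhds hs)

theorem analyticAt_Gamma_of_re_pos {s : ℂ} (hs : 0 < s.re) : AnalyticAt ℂ Gamma s := by
  refine DifferentiableOn.analyticAt (s := {s : ℂ | 0 < s.re}) (fun s h ↦ ?_)
    (isOpen_zero_lt_re.mem_nhds hs)
  refine (differentiableAt_Gamma s fun m hm ↦ ?_).differentiableWithinAt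
  have hre : 0 < s.re := h
  rw [hm, neg_re, natCast_re] at hre
  linarith [m.cast_nonneg (α := ℝ)]

theorem G_eq_neg_Gamma_mul_expZeta_half {s : ℂ} (hs : 0 < s.re) :
    G s = -(Gamma s * expZeta ((1 / 2 : ℝ) : UnitAddCircle) s) := by
  refine AnalyticOnNhd.eqOn_of_preconnected_of_eventuallyEq
    (g := fun s ↦ -(Gamma s * expZeta ((1 / 2 : ℝ) : UnitAddCircle) s))
    (U := {s : ℂ | 0 < s.re}) (z₀ := 2)
    (fun s h ↦ analyticAt_G h)
    (fun s h ↦ ((analyticAt_Gamma_of_re_pos h).mul (analyticAt_expZeta_half s)).neg)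
    (convex_halfSpace_re_gt 0).isPreconnected (by simp) ?_ hs
  filter_upwards [eventually_one_lt_re_nhds_two] with s hs using G_of_one_lt_re hs

theorem two_cpow_one_sub_ne_one {s : ℂ} (hs : s.re < 1) : (2 : ℂ) ^ (1 - s) ≠ 1 := by
  intro h
  have hn := congrArg norm h
  rw [← ofReal_ofNat, norm_cpow_eq_rpow_re_of_pos two_pos, norm_one] at hn
  exact (Real.one_lt_rpow one_lt_two (by simpa using hs)).ne' hn

theorem analyticOrderAt_G {z : ℂ} (hz₀ : 0 < z.re) (hz₁ : z.re < 1) :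
    analyticOrderAt G z = analyticOrderAt riemannZeta z := by
  have hz : z ≠ 1 := by
    rintro rfl
    simp at hz₁
  have hg : AnalyticAt ℂ (fun s : ℂ ↦ -(Gamma s * ((2 : ℂ) ^ (1 - s) - 1))) z :=
    ((analyticAt_Gamma_of_re_pos hz₀).mul (analyticAt_two_cpow_one_sub_sub_one z)).neg
  have heq : G =ᶠ[𝓝 z] (fun s : ℂ ↦ -(Gamma s * ((2 : ℂ) ^ (1 - s) - 1))) * riemannZeta := by
    filter_upwards [isOpen_zero_lt_re.mem_nhds hz₀, isOpen_ne.mem_nhds hz] with s hs₀ hs₁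
    rw [G_eq_neg_Gamma_mul_expZeta_half hs₀, expZeta_half hs₁, Pi.mul_apply]
    ring
  rw [analyticOrderAt_congr heq, analyticOrderAt_mul hg (analyticOn_riemannZeta z hz),
    hg.analyticOrderAt_eq_zero.mpr, zero_add]
  exact neg_ne_zero.mpr (mul_ne_zero (Gamma_ne_zero_of_re_pos hz₀)
    (sub_ne_zero.mpr (two_cpow_one_sub_ne_one hz₁)))

theorem AnalyticAt.isZeroOfMultiplicity_iff {f : ℂ → ℂ} {z : ℂ} (hf : AnalyticAt ℂ f z) (μ : ℕ) :
    IsZeroOfMultiplicity f z μ ↔ analyticOrderAt f z = μ :=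
  (analyticOrderAt_eq_nat_iff_iteratedDeriv_eq_zero hf).symm

theorem G_zero_multiplicity_iff_zeta (z : ℂ) (hz : z.re ∈ Set.Ioo (0 : ℝ) 1)
    (μ : ℕ) (hμ : 1 ≤ μ) :
    IsZeroOfMultiplicity G z μ ↔ IsZeroOfMultiplicity riemannZeta z μ := by
  have hz₁ : z ≠ 1 := by
    rintro rfl
    simp at hz
  rw [(analyticAt_G hz.1).isZeroOfMultiplicity_iff,
    (analyticOn_riemannZeta z hz₁).isZeroOfMultiplicity_iff, analyticOrderAt_G hz.1 hz.2]
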